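/- arXiv:1003.4137 — 3 statements merged into one kernel-verified Lean document; each statement's English description precedes it below -/
import Mathlib

section
/- If S⁰ is a quasi-ideal adequate transversal of an abundant semigroup S, then L and R are subsemigroups of S, L is a left adequate semigroup, R is a right adequate semigroup, and S⁰ is a quasi-ideal adequate transversal of both L and R. -/
/-!
Common framework: "relative" semigroup-theoretic notions.  All notions are taken
relative to a carrier set `U` inside an ambient type, together with an explicit
binary operation `mul` (only the values of `mul` on `U` are relevant).  For an
honest semigroup `S` one takes `U = Set.univ` and `mul = mulOf S`.

* `RStarOn mul U a b` : the relation `a ℛ* b` computed in `U` with an identity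
  adjoined (the two clauses correspond to multipliers from `U` and to the
  adjoined identity).
* `LStarOn`, `GreenLOn`, `GreenROn` : dual / Green's relations.
* `AbundantOn`, `AdequateOn`, `LeftAdequateOn`, `RightAdequateOn`.
* `AdequateTransversalOn mul U S0` : `S0` is an adequate `*`-subsemigroup of `U`
  which is an adequate transversal, with the data `bar x = x̄`, `e x = e_x`,
  `f x = f_x`, and `plus s = s⁺`, `star s = s⋆` for `s ∈ S0`.
* `InverseTransversalOn mul U S0` : `S0` is an inverse transversal of the
  regular semigroup `U`, with `o x = x⁰` the unique inverse of `x` in `S0`.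
-/

namespace Paper

universe u

variable {α : Type*} {β : Type*} {γ : Type*}

def mulOf (α : Type*) [Mul α] : α → α → α := fun a b => a * b

/-- `x` is an idempotent for the operation `mul`. -/
def Idem (mul : α → α → α) (x : α) : Prop := mul x x = x

/-- The relation `ℛ*` on `U` (with an identity adjoined to `U`). -/
def RStarOn (mul : α → α → α) (U : Set α) (a b : α) : Prop :=
  (∀ x ∈ U, ∀ y ∈ U, (mul x a = mul y a ↔ mul x b = mul y b)) ∧
  (∀ x ∈ U, (mul x a = a ↔ mul x b = b))

/-- The relation `ℒ*` on `U` (with an identity adjoined to `U`). -/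
def LStarOn (mul : α → α → α) (U : Set α) (a b : α) : Prop :=
  (∀ x ∈ U, ∀ y ∈ U, (mul a x = mul a y ↔ mul b x = mul b y)) ∧
  (∀ x ∈ U, (mul a x = a ↔ mul b x = b))

/-- Green's relation `ℒ` on `U`: `U¹ a = U¹ b`. -/
def GreenLOn (mul : α → α → α) (U : Set α) (a b : α) : Prop :=
  (a = b ∨ ∃ u ∈ U, mul u b = a) ∧ (b = a ∨ ∃ v ∈ U, mul v a = b)

/-- Green's relation `ℛ` on `U`: `a U¹ = b U¹`. -/
def GreenROn (mul : α → α → α) (U : Set α) (a b : α) : Prop :=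
  (a = b ∨ ∃ u ∈ U, mul b u = a) ∧ (b = a ∨ ∃ v ∈ U, mul a v = b)

/-- `U` is closed under `mul`. -/
def ClosedOn (mul : α → α → α) (U : Set α) : Prop :=
  ∀ a ∈ U, ∀ b ∈ U, mul a b ∈ U

/-- `U` with the operation `mul` is a semigroup. -/
def SemigroupOn (mul : α → α → α) (U : Set α) : Prop :=
  ClosedOn mul U ∧ ∀ a ∈ U, ∀ b ∈ U, ∀ c ∈ U, mul (mul a b) c = mul a (mul b c)

/-- Every `ℛ*`-class and every `ℒ*`-class of `U` contains an idempotent. -/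
def AbundantOn (mul : α → α → α) (U : Set α) : Prop :=
  ∀ a ∈ U, (∃ e ∈ U, Idem mul e ∧ RStarOn mul U a e) ∧
           (∃ f ∈ U, Idem mul f ∧ LStarOn mul U a f)

/-- Abundant with commuting idempotents. -/
def AdequateOn (mul : α → α → α) (U : Set α) : Prop :=
  AbundantOn mul U ∧
    ∀ u ∈ U, ∀ v ∈ U, Idem mul u → Idem mul v → mul u v = mul v u

/-- Abundant, and every `ℛ*`-class contains a unique idempotent. -/
def LeftAdequateOn (mul : α → α → α) (U : Set α) : Prop :=
  AbundantOn mul U ∧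
    ∀ u ∈ U, ∀ v ∈ U, Idem mul u → Idem mul v → RStarOn mul U u v → u = v

/-- Abundant, and every `ℒ*`-class contains a unique idempotent. -/
def RightAdequateOn (mul : α → α → α) (U : Set α) : Prop :=
  AbundantOn mul U ∧
    ∀ u ∈ U, ∀ v ∈ U, Idem mul u → Idem mul v → LStarOn mul U u v → u = v

/-- `S0` is a quasi-ideal of `U` : `S0 U S0 ⊆ S0`. -/
def QuasiIdealOn (mul : α → α → α) (U S0 : Set α) : Prop :=
  ∀ s ∈ S0, ∀ x ∈ U, ∀ t ∈ S0, mul (mul s x) t ∈ S0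

/-- Every element of `U` has an inverse in `U`. -/
def RegularOn (mul : α → α → α) (U : Set α) : Prop :=
  ∀ x ∈ U, ∃ u ∈ U, mul (mul x u) x = x ∧ mul (mul u x) u = u

/-- Regular with commuting idempotents, i.e. an inverse semigroup. -/
def InverseSgpOn (mul : α → α → α) (U : Set α) : Prop :=
  RegularOn mul U ∧
    ∀ u ∈ U, ∀ v ∈ U, Idem mul u → Idem mul v → mul u v = mul v u

/-- Regular, and every Green `ℛ`-class contains a unique idempotent. -/
def LeftInverseSgpOn (mul : α → α → α) (U : Set α) : Prop :=
  RegularOn mul U ∧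
    ∀ u ∈ U, ∀ v ∈ U, Idem mul u → Idem mul v → GreenROn mul U u v → u = v

/-- Regular, and every Green `ℒ`-class contains a unique idempotent. -/
def RightInverseSgpOn (mul : α → α → α) (U : Set α) : Prop :=
  RegularOn mul U ∧
    ∀ u ∈ U, ∀ v ∈ U, Idem mul u → Idem mul v → GreenLOn mul U u v → u = v

/-- An isomorphism from `(A, mulA)` onto `(B, mulB)`. -/
def IsoOn (mulA : α → α → α) (mulB : β → β → β) (A : Set α) (B : Set β) : Prop :=
  ∃ θ : α → β, Set.BijOn θ A B ∧ ∀ a ∈ A, ∀ b ∈ A, θ (mulA a b) = mulB (θ a) (θ b)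

/-- `S0` is an adequate transversal of the abundant semigroup `U`.  `S0` is an
adequate `*`-subsemigroup of `U` (witnessed by `plus`/`star`, the canonical
idempotents `a⁺ ℛ* a`, `a⋆ ℒ* a` of elements of `S0`, the `ℛ*`/`ℒ*` relations
being those of the big semigroup `U`, which gives the `*`-subsemigroup property),
and every `x ∈ U` factors uniquely as `x = e_x x̄ f_x` with `x̄ ∈ S0`,
`e_x, f_x` idempotents of `U`, `e_x ℒ x̄⁺` and `f_x ℛ x̄⋆`. -/
structure AdequateTransversalOn (mul : α → α → α) (U S0 : Set α) where
  sub : S0 ⊆ U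
  mul_mem : ∀ a ∈ S0, ∀ b ∈ S0, mul a b ∈ S0
  bar : α → α
  e : α → α
  f : α → α
  plus : α → α
  star : α → α
  plus_mem : ∀ a ∈ S0, plus a ∈ S0
  plus_idem : ∀ a ∈ S0, Idem mul (plus a)
  plus_rstar : ∀ a ∈ S0, RStarOn mul U a (plus a)
  star_mem : ∀ a ∈ S0, star a ∈ S0
  star_idem : ∀ a ∈ S0, Idem mul (star a)
  star_lstar : ∀ a ∈ S0, LStarOn mul U a (star a)
  idem_comm : ∀ u ∈ S0, ∀ v ∈ S0, Idem mul u → Idem mul v → mul u v = mul v u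
  bar_mem : ∀ x ∈ U, bar x ∈ S0
  e_mem : ∀ x ∈ U, e x ∈ U
  f_mem : ∀ x ∈ U, f x ∈ U
  e_idem : ∀ x ∈ U, Idem mul (e x)
  f_idem : ∀ x ∈ U, Idem mul (f x)
  decomp : ∀ x ∈ U, x = mul (mul (e x) (bar x)) (f x)
  e_greenL : ∀ x ∈ U, GreenLOn mul U (e x) (plus (bar x))
  f_greenR : ∀ x ∈ U, GreenROn mul U (f x) (star (bar x))
  unique : ∀ x ∈ U, ∀ s ∈ S0, ∀ e' ∈ U, ∀ f' ∈ U, Idem mul e' → Idem mul f' →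
      x = mul (mul e' s) f' → GreenLOn mul U e' (plus s) → GreenROn mul U f' (star s) →
      s = bar x ∧ e' = e x ∧ f' = f x

namespace AdequateTransversalOn

variable {mul : α → α → α} {U S0 : Set α}

/-- `R = {x ∈ U : e_x = e_{x̄}}`. -/
def Rset (T : AdequateTransversalOn mul U S0) : Set α :=
  {x | x ∈ U ∧ T.e x = T.e (T.bar x)}

/-- `L = {x ∈ U : f_x = f_{x̄}}`. -/
def Lset (T : AdequateTransversalOn mul U S0) : Set α :=
  {x | x ∈ U ∧ T.f x = T.f (T.bar x)}

/-- `I = {e_x : x ∈ U}`. -/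
def Iset (T : AdequateTransversalOn mul U S0) : Set α :=
  {y | ∃ x ∈ U, T.e x = y}

/-- `Λ = {f_x : x ∈ U}`. -/
def LamSet (T : AdequateTransversalOn mul U S0) : Set α :=
  {y | ∃ x ∈ U, T.f x = y}

/-- The transversal is multiplicative: `Λ I ⊆ E⁰`. -/
def IsMultiplicative (T : AdequateTransversalOn mul U S0) : Prop :=
  ∀ l ∈ T.LamSet, ∀ i ∈ T.Iset, mul l i ∈ S0 ∧ Idem mul (mul l i)

end AdequateTransversalOn

/-- The spined product set `T = L |×| R ⊆ S × S` attached to an adequate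
transversal of `S` (ambient carrier `U`). -/
def spSet {mul : α → α → α} {U S0 : Set α}
    (T : AdequateTransversalOn mul U S0) : Set (α × α) :=
  {p | p.1 ∈ T.Lset ∧ p.2 ∈ T.Rset ∧ T.bar p.1 = T.bar p.2}

/-- The multiplication `(x,a)(y,b) = (e_x(ay), (ay) f_b)` on the spined product. -/
def spMul {mul : α → α → α} {U S0 : Set α}
    (T : AdequateTransversalOn mul U S0) : α × α → α × α → α × α :=
  fun p q => (mul (T.e p.1) (mul p.2 q.1), mul (mul p.2 q.1) (T.f q.2))

/-- The map `φ : S → T`, `x ↦ (e_x x̄, x̄ f_x)`. -/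
def phiMap {mul : α → α → α} {U S0 : Set α}
    (T : AdequateTransversalOn mul U S0) : α → α × α :=
  fun x => (mul (T.e x) (T.bar x), mul (T.bar x) (T.f x))

/-- `T⁰ = {(s,s) : s ∈ S0}`. -/
def diagSet (S0 : Set α) : Set (α × α) := {p | ∃ s ∈ S0, p = (s, s)}

/-- Abstract spined product `L |×| R` over a common transversal `S⁰` (a type `γ`
embedded into `L` and `R` by `jL`, `jR`). -/
def absTset {mulL : α → α → α} {mulR : β → β → β} {jL : γ → α} {jR : γ → β}
    (TL : AdequateTransversalOn mulL Set.univ (Set.range jL))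
    (TR : AdequateTransversalOn mulR Set.univ (Set.range jR)) : Set (α × β) :=
  {p | ∃ s : γ, jL s = TL.bar p.1 ∧ jR s = TR.bar p.2}

/-- The multiplication `(x,a)(y,b) = (e_x(a∗y), (a∗y) f_b)`. -/
def absMul {mulL : α → α → α} {mulR : β → β → β} {jL : γ → α} {jR : γ → β}
    (TL : AdequateTransversalOn mulL Set.univ (Set.range jL))
    (TR : AdequateTransversalOn mulR Set.univ (Set.range jR))
    (st : β → α → γ) : α × β → α × β → α × β :=
  fun p q => (mulL (TL.e p.1) (jL (st p.2 q.1)), mulR (jR (st p.2 q.1)) (TR.f q.2))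

/-- `T⁰ = {(s,s) : s ∈ S⁰}` inside `L × R`, where `s` is viewed in `L` and in `R`. -/
def absT0 (jL : γ → α) (jR : γ → β) : Set (α × β) :=
  {p | ∃ s : γ, p = (jL s, jR s)}

/-- `S0` is an inverse transversal of the regular semigroup `U`: an inverse
subsemigroup meeting the set of inverses of each `x ∈ U` in exactly one
element `o x = x⁰`. -/
structure InverseTransversalOn (mul : α → α → α) (U S0 : Set α) where
  sub : S0 ⊆ U
  mul_mem : ∀ a ∈ S0, ∀ b ∈ S0, mul a b ∈ S0
  o : α → α
  o_mem : ∀ x ∈ U, o x ∈ S0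
  o_inv1 : ∀ x ∈ U, mul (mul x (o x)) x = x
  o_inv2 : ∀ x ∈ U, mul (mul (o x) x) (o x) = o x
  o_unique : ∀ x ∈ U, ∀ u ∈ S0, mul (mul x u) x = x → mul (mul u x) u = u → u = o x
  idem_comm : ∀ u ∈ S0, ∀ v ∈ S0, Idem mul u → Idem mul v → mul u v = mul v u

namespace InverseTransversalOn

variable {mul : α → α → α} {U S0 : Set α}

/-- `L = {x ∈ U : x⁰x ∈ E⁰}`. -/
def LsetI (T : InverseTransversalOn mul U S0) : Set α :=
  {x | x ∈ U ∧ mul (T.o x) x ∈ S0 ∧ Idem mul (mul (T.o x) x)}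

/-- `R = {x ∈ U : xx⁰ ∈ E⁰}`. -/
def RsetI (T : InverseTransversalOn mul U S0) : Set α :=
  {x | x ∈ U ∧ mul x (T.o x) ∈ S0 ∧ Idem mul (mul x (T.o x))}

end InverseTransversalOn

/-- Spined product set for an inverse transversal: `{(x,a) : x⁰ = a⁰}`. -/
def invSpSet {mul : α → α → α} {U S0 : Set α}
    (T : InverseTransversalOn mul U S0) : Set (α × α) :=
  {p | p.1 ∈ T.LsetI ∧ p.2 ∈ T.RsetI ∧ T.o p.1 = T.o p.2}

/-- The multiplication `(x,a)(y,b) = ((xx⁰)(ay), (ay)(b⁰b))`. -/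
def invSpMul {mul : α → α → α} {U S0 : Set α}
    (T : InverseTransversalOn mul U S0) : α × α → α × α → α × α :=
  fun p q => (mul (mul p.1 (T.o p.1)) (mul p.2 q.1),
              mul (mul p.2 q.1) (mul (T.o q.2) q.2))

/-- Abstract spined product for inverse transversals: `{(x,a) : x⁰ = a⁰}`. -/
def invAbsTset {mulL : α → α → α} {mulR : β → β → β} {jL : γ → α} {jR : γ → β}
    (TL : InverseTransversalOn mulL Set.univ (Set.range jL))
    (TR : InverseTransversalOn mulR Set.univ (Set.range jR)) : Set (α × β) :=
  {p | ∃ s : γ, jL s = TL.o p.1 ∧ jR s = TR.o p.2}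

/-- The multiplication `(x,a)(y,b) = ((xx⁰)(a∗y), (a∗y)(b⁰b))`. -/
def invAbsMul {mulL : α → α → α} {mulR : β → β → β} {jL : γ → α} {jR : γ → β}
    (TL : InverseTransversalOn mulL Set.univ (Set.range jL))
    (TR : InverseTransversalOn mulR Set.univ (Set.range jR))
    (st : β → α → γ) : α × β → α × β → α × β :=
  fun p q => (mulL (mulL p.1 (TL.o p.1)) (jL (st p.2 q.1)),
              mulR (jR (st p.2 q.1)) (mulR (TR.o q.2) q.2))

/-- The multiplication `(e,x)(g,w) = (e(aa⁻¹), a)`, `a = x((x⁻¹x)g)w`, on `I × S⁰`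
(Chen-style construction from a left normal band `I` with semilattice transversal
`E⁰ = E(S⁰)`; `σ` embeds idempotents of the inverse semigroup `γ` into the band
`β`, and `π : β → γ` is the semilattice-transversal map `e ↦ e⁰`). -/
def bandMul (mulB : β → β → β) (mulG : γ → γ → γ) (σ : γ → β) (π : β → γ)
    (inv : γ → γ) (p q : β × γ) : β × γ :=
  let a := mulG (mulG p.2 (π (mulB (σ (mulG (inv p.2) p.2)) q.1))) q.2
  (mulB p.1 (σ (mulG a (inv a))), a)

/-- `T = {(e,x) : e⁰ = xx⁻¹}`. -/
def bandTset (mulG : γ → γ → γ) (π : β → γ) (inv : γ → γ) : Set (β × γ) :=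
  {p | π p.1 = mulG p.2 (inv p.2)}

/-- `T⁰ = {(aa⁻¹, a) : a ∈ S⁰}` (with `aa⁻¹` viewed in the band via `σ`). -/
def bandT0 (mulG : γ → γ → γ) (σ : γ → β) (inv : γ → γ) : Set (β × γ) :=
  {p | ∃ s : γ, p = (σ (mulG s (inv s)), s)}

end Paper

namespace Paper

theorem GreenLOn.of_mul {α : Type*} {mul : α → α → α} {U : Set α} {a b : α}
    (ha : a ∈ U) (hb : b ∈ U) (hab : mul a b = a) (hba : mul b a = b) : GreenLOn mul U a b :=
  ⟨Or.inr ⟨a, ha, hab⟩, Or.inr ⟨b, hb, hba⟩⟩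

theorem GreenLOn.mono {α : Type*} {mul : α → α → α} {U V : Set α} (hUV : U ⊆ V) {a b : α}
    (h : GreenLOn mul U a b) : GreenLOn mul V a b :=
  ⟨h.1.imp_right fun ⟨u, hu, e⟩ => ⟨u, hUV hu, e⟩, h.2.imp_right fun ⟨u, hu, e⟩ => ⟨u, hUV hu, e⟩⟩

theorem GreenROn.mono {α : Type*} {mul : α → α → α} {U V : Set α} (hUV : U ⊆ V) {a b : α}
    (h : GreenROn mul U a b) : GreenROn mul V a b :=
  ⟨h.1.imp_right fun ⟨u, hu, e⟩ => ⟨u, hUV hu, e⟩, h.2.imp_right fun ⟨u, hu, e⟩ => ⟨u, hUV hu, e⟩⟩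

theorem RStarOn.anti {α : Type*} {mul : α → α → α} {U V : Set α} (hUV : U ⊆ V) {a b : α}
    (h : RStarOn mul V a b) : RStarOn mul U a b :=
  ⟨fun x hx y hy => h.1 x (hUV hx) y (hUV hy), fun x hx => h.2 x (hUV hx)⟩

theorem LStarOn.anti {α : Type*} {mul : α → α → α} {U V : Set α} (hUV : U ⊆ V) {a b : α}
    (h : LStarOn mul V a b) : LStarOn mul U a b :=
  ⟨fun x hx y hy => h.1 x (hUV hx) y (hUV hy), fun x hx => h.2 x (hUV hx)⟩

theorem mul_eq_of_greenLOn {S : Type*} [Semigroup S] {U : Set S} {a b : S}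
    (ha : a * a = a) (hb : b * b = b) (h : GreenLOn (mulOf S) U a b) :
    a * b = a ∧ b * a = b := by
  constructor
  · rcases h.1 with rfl | ⟨u, -, rfl⟩
    · exact ha
    · simp only [mulOf, mul_assoc, hb]
  · rcases h.2 with rfl | ⟨u, -, rfl⟩
    · exact ha
    · simp only [mulOf, mul_assoc, ha]

/-- The semigroup with the opposite multiplication on the same type. -/
abbrev opSemigroup (S : Type*) [Semigroup S] : Semigroup S where
  mul a b := b * a
  mul_assoc a b c := (mul_assoc c b a).symm

namespace AdequateTransversalOn

/-- The transversal for the opposite multiplication. -/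
def op {S : Type*} [Semigroup S] {U S0 : Set S} (T : AdequateTransversalOn (mulOf S) U S0) :
    AdequateTransversalOn (fun a b : S => b * a) U S0 where
  sub := T.sub
  mul_mem a ha b hb := T.mul_mem b hb a ha
  bar := T.bar
  e := T.f
  f := T.e
  plus := T.star
  star := T.plus
  plus_mem := T.star_mem
  plus_idem := T.star_idem
  plus_rstar := T.star_lstar
  star_mem := T.plus_mem
  star_idem := T.plus_idem
  star_lstar := T.plus_rstar
  idem_comm u hu v hv hui hvi := T.idem_comm v hv u hu hvi hui
  bar_mem := T.bar_mem
  e_mem := T.f_mem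
  f_mem := T.e_mem
  e_idem := T.f_idem
  f_idem := T.e_idem
  decomp x hx := (T.decomp x hx).trans (mul_assoc _ _ _)
  e_greenL := T.f_greenR
  f_greenR := T.e_greenL
  unique x hx s hs e' he' f' hf' hei hfi hxe hl hr :=
    let h := T.unique x hx s hs f' hf' e' he' hfi hei (hxe.trans (mul_assoc _ _ _).symm) hr hl
    ⟨h.1, h.2.2, h.2.1⟩

variable {S : Type*} [Semigroup S] {S0 : Set S}
  (T : AdequateTransversalOn (mulOf S) Set.univ S0)

include T

theorem plus_mul_plus {s : S} (hs : s ∈ S0) : T.plus s * T.plus s = T.plus s :=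
  T.plus_idem s hs

theorem star_mul_star {s : S} (hs : s ∈ S0) : T.star s * T.star s = T.star s :=
  T.star_idem s hs

theorem mul_eq_self_iff_plus {s : S} (hs : s ∈ S0) (x : S) :
    x * s = s ↔ x * T.plus s = T.plus s :=
  (T.plus_rstar s hs).2 x trivial

theorem mul_eq_mul_iff_plus {s : S} (hs : s ∈ S0) (x y : S) :
    x * s = y * s ↔ x * T.plus s = y * T.plus s :=
  (T.plus_rstar s hs).1 x trivial y trivial

theorem plus_mul {s : S} (hs : s ∈ S0) : T.plus s * s = s :=
  (T.mul_eq_self_iff_plus hs _).2 (T.plus_mul_plus hs)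

theorem mul_star {s : S} (hs : s ∈ S0) : s * T.star s = s :=
  ((T.star_lstar s hs).2 _ trivial).2 (T.star_idem s hs)

theorem plus_eq {s p : S} (hs : s ∈ S0) (hp : p ∈ S0) (hpp : p * p = p) (hps : p * s = s)
    (h : T.plus s * p = p) : T.plus s = p := by
  rw [← (T.mul_eq_self_iff_plus hs p).1 hps]
  exact (T.idem_comm p hp _ (T.plus_mem s hs) hpp (T.plus_idem s hs)).trans h

theorem plus_of_idem {p : S} (hp : p ∈ S0) (hpp : p * p = p) : T.plus p = p :=
  T.plus_eq hp hp hpp hpp (T.plus_mul hp)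

theorem decomp_mul {e s : S} (hs : s ∈ S0) (he : e * e = e) (h1 : e * T.plus s = e)
    (h2 : T.plus s * e = T.plus s) :
    s = T.bar (e * s) ∧ e = T.e (e * s) ∧ T.star s = T.f (e * s) :=
  T.unique _ trivial s hs e trivial _ trivial he (T.star_idem s hs)
    (show e * s = e * s * T.star s by rw [mul_assoc, T.mul_star hs])
    (.of_mul trivial trivial h1 h2) ⟨Or.inl rfl, Or.inl rfl⟩

theorem decomp_of_mem {s : S} (hs : s ∈ S0) :
    s = T.bar s ∧ T.plus s = T.e s ∧ T.star s = T.f s := by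
  have h := T.plus_mul_plus hs
  simpa only [T.plus_mul hs] using T.decomp_mul hs h h h

theorem mul_mem_Lset {e s : S} (hs : s ∈ S0) (he : e * e = e) (h1 : e * T.plus s = e)
    (h2 : T.plus s * e = T.plus s) : e * s ∈ T.Lset := by
  obtain ⟨hb, -, hf⟩ := T.decomp_mul hs he h1 h2
  exact ⟨trivial, by rw [← hf, ← hb, ← (T.decomp_of_mem hs).2.2]⟩

theorem subset_Lset : S0 ⊆ T.Lset := fun s hs =>
  ⟨trivial, by rw [← (T.decomp_of_mem hs).1]⟩

theorem f_eq_of_mem_Lset {x : S} (hx : x ∈ T.Lset) : T.f x = T.star (T.bar x) := by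
  rw [hx.2, ← (T.decomp_of_mem (T.bar_mem x trivial)).2.2]

theorem e_mul_plus_bar (x : S) :
    T.e x * T.plus (T.bar x) = T.e x ∧ T.plus (T.bar x) * T.e x = T.plus (T.bar x) :=
  mul_eq_of_greenLOn (T.e_idem x trivial) (T.plus_idem _ (T.bar_mem x trivial))
    (T.e_greenL x trivial)

theorem e_mul_bar_of_mem_Lset {x : S} (hx : x ∈ T.Lset) : x = T.e x * T.bar x := by
  have h : x = T.e x * T.bar x * T.f x := T.decomp x trivial
  rwa [T.f_eq_of_mem_Lset hx, mul_assoc, T.mul_star (T.bar_mem x trivial)] at h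

theorem exists_of_mem_Lset {x : S} (hx : x ∈ T.Lset) :
    ∃ e s, s ∈ S0 ∧ e * e = e ∧ e * T.plus s = e ∧ T.plus s * e = T.plus s ∧ x = e * s :=
  ⟨T.e x, T.bar x, T.bar_mem x trivial, T.e_idem x trivial, (T.e_mul_plus_bar x).1,
    (T.e_mul_plus_bar x).2, T.e_mul_bar_of_mem_Lset hx⟩

/-- Idempotents that are `ℒ`-related to an idempotent of the transversal lie in `L`. -/
theorem idem_mem_Lset {e p : S} (hp : p ∈ S0) (hpp : p * p = p) (he : e * e = e)
    (h1 : e * p = e) (h2 : p * e = p) : e ∈ T.Lset := by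
  have h := T.plus_of_idem hp hpp
  have := T.mul_mem_Lset (e := e) hp he (by rw [h, h1]) (by rw [h, h2])
  rwa [h1] at this

theorem e_mem_Lset (x : S) : T.e x ∈ T.Lset :=
  have hb := T.bar_mem x trivial
  T.idem_mem_Lset (T.plus_mem _ hb) (T.plus_mul_plus hb) (T.e_idem x trivial)
    (T.e_mul_plus_bar x).1 (T.e_mul_plus_bar x).2

theorem rstarOn_mul {e s : S} (hs : s ∈ S0) (h1 : e * T.plus s = e) :
    RStarOn (mulOf S) Set.univ (e * s) e := by
  refine ⟨fun x _ y _ => ?_, fun x _ => ?_⟩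
  · have := T.mul_eq_mul_iff_plus hs (x * e) (y * e)
    simpa only [mulOf, mul_assoc, h1] using this
  · have := T.mul_eq_mul_iff_plus hs (x * e) e
    simpa only [mulOf, mul_assoc, h1] using this

theorem lstarOn_mul {e s : S} (hs : s ∈ S0) (h2 : T.plus s * e = T.plus s) :
    LStarOn (mulOf S) Set.univ (e * s) (T.star s) := by
  have h : ∀ x y, e * (s * x) = e * (s * y) ↔ s * x = s * y := by
    refine fun x y => ⟨fun hxy => ?_, fun hxy => by rw [hxy]⟩
    have := congrArg (T.plus s * ·) hxy
    simpa only [← mul_assoc, h2, T.plus_mul hs] using this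
  refine ⟨fun x _ y _ => ?_, fun x _ => ?_⟩
  · have := h x y
    simpa only [mulOf, mul_assoc] using this.trans ((T.star_lstar s hs).1 x trivial y trivial)
  · have := h x (T.star s)
    rw [T.mul_star hs] at this
    simpa only [mulOf, mul_assoc] using this.trans ((T.star_lstar s hs).2 x trivial)

theorem closedOn_Lset (hq : QuasiIdealOn (mulOf S) Set.univ S0) :
    ClosedOn (mulOf S) T.Lset := by
  intro x hx y hy
  obtain ⟨e, s, hs, he, h1, h2, rfl⟩ := T.exists_of_mem_Lset hx
  obtain ⟨g, t, ht, -, -, -, rfl⟩ := T.exists_of_mem_Lset hy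
  have hw : s * g * t ∈ S0 := hq s hs g trivial t ht
  generalize hwd : s * g * t = w at hw
  have hsw : T.plus s * T.plus w = T.plus w := by
    rw [← T.mul_eq_self_iff_plus hw, ← hwd, ← mul_assoc, ← mul_assoc, T.plus_mul hs]
  have hws : T.plus w * T.plus s = T.plus w :=
    (T.idem_comm _ (T.plus_mem w hw) _ (T.plus_mem s hs) (T.plus_idem w hw)
      (T.plus_idem s hs)).trans hsw
  have hwe : T.plus w * e = T.plus w := by rw [← hws, mul_assoc, h2]
  have hxy : mulOf S (e * s) (g * t) = e * T.plus w * w := by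
    rw [mul_assoc, T.plus_mul hw, ← hwd]
    simp only [mulOf, mul_assoc]
  rw [hxy]
  apply T.mul_mem_Lset hw
  · rw [mul_assoc, ← mul_assoc (T.plus w), hwe, T.plus_mul_plus hw]
  · rw [mul_assoc, T.plus_mul_plus hw]
  · rw [← mul_assoc, hwe, T.plus_mul_plus hw]

theorem abundantOn_Lset : AbundantOn (mulOf S) T.Lset := by
  intro x hx
  have hb := T.bar_mem x trivial
  have h := T.e_mul_bar_of_mem_Lset hx
  refine ⟨⟨T.e x, T.e_mem_Lset x, T.e_idem x trivial, ?_⟩,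
    ⟨T.star (T.bar x), T.subset_Lset (T.star_mem _ hb), T.star_idem _ hb, ?_⟩⟩
  · have := T.rstarOn_mul hb (T.e_mul_plus_bar x).1
    rw [← h] at this
    exact this.anti (Set.subset_univ _)
  · have := T.lstarOn_mul hb (T.e_mul_plus_bar x).2
    rw [← h] at this
    exact this.anti (Set.subset_univ _)

/-- An idempotent `u` of `L` satisfies `e_u = u` and is `ℒ`-related to an idempotent of the
transversal. -/
theorem idem_of_mem_Lset {u : S} (hu : u ∈ T.Lset) (huu : u * u = u) :
    T.e u = u ∧ ∃ p ∈ S0, p * p = p ∧ u * p = u ∧ p * u = p := by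
  have hs := T.bar_mem u trivial
  have h2 := (T.e_mul_plus_bar u).2
  have hes := T.e_mul_bar_of_mem_Lset hu
  generalize T.bar u = s at *
  generalize hed : T.e u = e at *
  have hses : s * (e * s) = s := by
    have := congrArg (T.plus s * ·) huu
    rw [hes] at this
    simpa only [mul_assoc, ← mul_assoc (T.plus s), h2, T.plus_mul hs] using this
  have hq0 := T.star_mem s hs
  have hqq := T.star_mul_star hs
  have hst : T.star s * (e * s) = T.star s := by
    have hl : T.star s * (T.star s * (e * s)) = T.star s := by
      refine ((T.star_lstar s hs).2 _ trivial).1 ?_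
      simp only [mulOf]
      rw [← mul_assoc, T.mul_star hs, hses]
    rwa [← mul_assoc, hqq] at hl
  rw [← hes] at hst
  have hus : u * T.star s = u := by rw [hes, mul_assoc, T.mul_star hs]
  have hp := T.plus_of_idem hq0 hqq
  have hd := T.decomp_mul (e := u) hq0 huu (by rw [hp, hus]) (by rw [hp, hst])
  rw [hus] at hd
  exact ⟨hed.symm.trans hd.2.1.symm, T.star s, hq0, hqq, hus, hst⟩

theorem leftAdequateOn_Lset (hq : QuasiIdealOn (mulOf S) Set.univ S0) :
    LeftAdequateOn (mulOf S) T.Lset := by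
  refine ⟨T.abundantOn_Lset, fun u hu v hv huu hvv hR => ?_⟩
  have huv : u * v = v := (hR.2 u hu).1 huu
  have hvu : v * u = u := (hR.2 v hv).2 hvv
  obtain ⟨-, p, hp, hpp, hup, hpu⟩ := T.idem_of_mem_Lset hu huu
  obtain ⟨hev, r, hr, -, hvr, -⟩ := T.idem_of_mem_Lset hv hvv
  have hpv : p * v ∈ S0 := by
    have : p * v * r ∈ S0 := hq p hp v trivial r hr
    rwa [mul_assoc, hvr] at this
  have hplus : T.plus (p * v) = p := by
    refine T.plus_eq hpv hp hpp (by rw [← mul_assoc, hpp]) ?_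
    have := congrArg (· * u) (T.plus_mul hpv)
    simpa only [mul_assoc, hvu, hpu] using this
  have hd := T.decomp_mul (e := u) hpv huu (by rw [hplus, hup]) (by rw [hplus, hpu])
  rw [← mul_assoc, hup, huv, hev] at hd
  exact hd.2.1

/-- A quasi-ideal adequate transversal of `S` is an adequate transversal of `L`. -/
def onLset : AdequateTransversalOn (mulOf S) T.Lset S0 where
  sub := T.subset_Lset
  mul_mem := T.mul_mem
  bar := T.bar
  e := T.e
  f := T.f
  plus := T.plus
  star := T.star
  plus_mem := T.plus_mem
  plus_idem := T.plus_idem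
  plus_rstar a ha := (T.plus_rstar a ha).anti (Set.subset_univ _)
  star_mem := T.star_mem
  star_idem := T.star_idem
  star_lstar a ha := (T.star_lstar a ha).anti (Set.subset_univ _)
  idem_comm := T.idem_comm
  bar_mem x _ := T.bar_mem x trivial
  e_mem x _ := T.e_mem_Lset x
  f_mem x hx := by
    rw [T.f_eq_of_mem_Lset hx]
    exact T.subset_Lset (T.star_mem _ (T.bar_mem x trivial))
  e_idem x _ := T.e_idem x trivial
  f_idem x _ := T.f_idem x trivial
  decomp x _ := T.decomp x trivial
  e_greenL x _ := .of_mul (T.e_mem_Lset x)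
    (T.subset_Lset (T.plus_mem _ (T.bar_mem x trivial)))
    (T.e_mul_plus_bar x).1 (T.e_mul_plus_bar x).2
  f_greenR x hx := by
    rw [T.f_eq_of_mem_Lset hx]
    exact ⟨Or.inl rfl, Or.inl rfl⟩
  unique x _ s hs e' _ f' _ hei hfi hx hl hr :=
    T.unique x trivial s hs e' trivial f' trivial hei hfi hx (hl.mono (Set.subset_univ _))
      (hr.mono (Set.subset_univ _))

end AdequateTransversalOn

end Paper

open Paper in
/-- If `S⁰` is a quasi-ideal adequate transversal of an abundant
semigroup `S`, then `L` and `R` are subsemigroups of `S`, `L` is left adequate,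
`R` is right adequate, and `S⁰` is a quasi-ideal adequate transversal of both. -/
theorem stmt1 {S : Type*} [Semigroup S] (S0 : Set S)
    (hS : AbundantOn (mulOf S) Set.univ)
    (T : AdequateTransversalOn (mulOf S) Set.univ S0)
    (hq : QuasiIdealOn (mulOf S) Set.univ S0) :
    ClosedOn (mulOf S) T.Lset ∧ ClosedOn (mulOf S) T.Rset ∧
    LeftAdequateOn (mulOf S) T.Lset ∧ RightAdequateOn (mulOf S) T.Rset ∧
    Nonempty (AdequateTransversalOn (mulOf S) T.Lset S0) ∧
    Nonempty (AdequateTransversalOn (mulOf S) T.Rset S0) ∧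
    QuasiIdealOn (mulOf S) T.Lset S0 ∧
    QuasiIdealOn (mulOf S) T.Rset S0 := by
  let Top : AdequateTransversalOn (@mulOf S (opSemigroup S).toMul) Set.univ S0 := T.op
  have hqop : QuasiIdealOn (@mulOf S (opSemigroup S).toMul) Set.univ S0 := fun s hs x hx t ht => by
    have h : t * x * s ∈ S0 := hq t ht x hx s hs
    rwa [mul_assoc] at h
  have hR := @AdequateTransversalOn.leftAdequateOn_Lset S (opSemigroup S) S0 Top hqop
  refine ⟨T.closedOn_Lset hq, fun a ha b hb => ?_, T.leftAdequateOn_Lset hq,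
    ⟨fun a ha => (hR.1 a ha).symm, hR.2⟩, ⟨T.onLset⟩,
    ⟨@AdequateTransversalOn.op S (opSemigroup S) _ _
      (@AdequateTransversalOn.onLset S (opSemigroup S) S0 Top)⟩,
    fun s hs x _ t ht => hq s hs x trivial t ht, fun s hs x _ t ht => hq s hs x trivial t ht⟩
  exact @AdequateTransversalOn.closedOn_Lset S (opSemigroup S) S0 Top hqop b hb a ha
end

section
/- Let S be a left adequate semigroup with an adequate transversal S⁰. Then for every x ∈ S, f_x = f_{x̄} and consequently x = e_x x̄. -/
namespace Paper

/-- In a semigroup, Green's relation `ℛ` is contained in `ℛ*`. -/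
theorem GreenROn.rStarOn {S : Type*} [Semigroup S] {a b : S}
    (h : GreenROn (mulOf S) Set.univ a b) : RStarOn (mulOf S) Set.univ a b := by
  obtain ⟨hab, hba⟩ := h
  simp only [RStarOn, mulOf, Set.mem_univ, true_and, forall_true_left] at *
  rcases hab with rfl | ⟨u, hu⟩
  · exact ⟨fun _ _ => Iff.rfl, fun _ => Iff.rfl⟩
  rcases hba with rfl | ⟨v, hv⟩
  · exact ⟨fun _ _ => Iff.rfl, fun _ => Iff.rfl⟩
  refine ⟨fun x y => ⟨fun h => ?_, fun h => ?_⟩, fun x => ⟨fun h => ?_, fun h => ?_⟩⟩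
  · rw [← hv, ← mul_assoc, ← mul_assoc, h]
  · rw [← hu, ← mul_assoc, ← mul_assoc, h]
  · rw [← hv, ← mul_assoc, h]
  · rw [← hu, ← mul_assoc, h]

namespace AdequateTransversalOn

variable {S : Type*} [Semigroup S] {S0 : Set S}

theorem plus_mul_self (T : AdequateTransversalOn (mulOf S) Set.univ S0) {s : S} (hs : s ∈ S0) :
    T.plus s * s = s :=
  ((T.plus_rstar s hs).2 (T.plus s) trivial).2 (T.plus_idem s hs)

theorem mul_star_self (T : AdequateTransversalOn (mulOf S) Set.univ S0) {s : S} (hs : s ∈ S0) :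
    s * T.star s = s :=
  ((T.star_lstar s hs).2 (T.star s) trivial).2 (T.star_idem s hs)

theorem f_eq_star_of_mem (T : AdequateTransversalOn (mulOf S) Set.univ S0) {s : S}
    (hs : s ∈ S0) : T.f s = T.star s := by
  refine (T.unique s trivial s hs (T.plus s) trivial (T.star s) trivial (T.plus_idem s hs)
    (T.star_idem s hs) ?_ ⟨.inl rfl, .inl rfl⟩ ⟨.inl rfl, .inl rfl⟩).2.2.symm
  simp only [mulOf, T.plus_mul_self hs, T.mul_star_self hs]

theorem f_eq_star_bar (T : AdequateTransversalOn (mulOf S) Set.univ S0)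
    (hS : LeftAdequateOn (mulOf S) Set.univ) (x : S) : T.f x = T.star (T.bar x) :=
  hS.2 _ trivial _ trivial (T.f_idem x trivial) (T.star_idem _ (T.bar_mem x trivial))
    (T.f_greenR x trivial).rStarOn

end AdequateTransversalOn

end Paper

open Paper in
/-- Let `S` be a left adequate semigroup with an adequate
transversal `S⁰`. Then for all `x ∈ S`, `f_x = f_{x̄}` and so `x = e_x x̄`. -/
theorem stmt2 {S : Type*} [Semigroup S] (S0 : Set S)
    (hS : LeftAdequateOn (mulOf S) Set.univ)
    (T : AdequateTransversalOn (mulOf S) Set.univ S0) :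
    ∀ x : S, T.f x = T.f (T.bar x) ∧ x = T.e x * T.bar x := by
  intro x
  have hx : T.bar x ∈ S0 := T.bar_mem x trivial
  refine ⟨by rw [T.f_eq_star_bar hS, T.f_eq_star_of_mem hx], ?_⟩
  have h : x = T.e x * T.bar x * T.f x := T.decomp x trivial
  rwa [T.f_eq_star_bar hS, mul_assoc, T.mul_star_self hx] at h
end

section
/- Let S⁰ be a quasi-ideal adequate transversal of an abundant semigroup S and let T = {(x,a) ∈ L × R : x̄ = ā}. If (x,a) ∈ T then x f_a = e_x a. -/
namespace Paper.AdequateTransversalOn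

variable {S : Type*} [Semigroup S] {S0 : Set S}

theorem plus_eq_e_and_star_eq_f (T : AdequateTransversalOn (mulOf S) Set.univ S0) {s : S}
    (hs : s ∈ S0) : T.plus s = T.e s ∧ T.star s = T.f s := by
  refine (T.unique s trivial s hs (T.plus s) trivial (T.star s) trivial (T.plus_idem s hs)
    (T.star_idem s hs) ?_ ⟨Or.inl rfl, Or.inl rfl⟩ ⟨Or.inl rfl, Or.inl rfl⟩).2
  change s = T.plus s * s * T.star s
  rw [T.plus_mul_self hs, T.mul_star_self hs]

theorem eq_e_mul_bar (T : AdequateTransversalOn (mulOf S) Set.univ S0) {x : S}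
    (hx : x ∈ T.Lset) : x = T.e x * T.bar x := by
  have hs := T.bar_mem x trivial
  have h : x = T.e x * T.bar x * T.f x := T.decomp x trivial
  rwa [hx.2, ← (T.plus_eq_e_and_star_eq_f hs).2, mul_assoc, T.mul_star_self hs] at h

theorem eq_bar_mul_f (T : AdequateTransversalOn (mulOf S) Set.univ S0) {a : S}
    (ha : a ∈ T.Rset) : a = T.bar a * T.f a := by
  have hs := T.bar_mem a trivial
  have h : a = T.e a * T.bar a * T.f a := T.decomp a trivial
  rwa [ha.2, ← (T.plus_eq_e_and_star_eq_f hs).1, T.plus_mul_self hs] at h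

end Paper.AdequateTransversalOn

open Paper in
/-- Let `S⁰` be a quasi-ideal adequate transversal of an abundant
semigroup `S`. If `(x,a) ∈ T = {(x,a) ∈ L × R : x̄ = ā}` then `x f_a = e_x a`. -/
theorem stmt3 {S : Type*} [Semigroup S] (S0 : Set S)
    (hS : AbundantOn (mulOf S) Set.univ)
    (T : AdequateTransversalOn (mulOf S) Set.univ S0)
    (hq : QuasiIdealOn (mulOf S) Set.univ S0) :
    ∀ x a : S, x ∈ T.Lset → a ∈ T.Rset → T.bar x = T.bar a →
      x * T.f a = T.e x * a := by
  intro x a hx ha h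
  calc x * T.f a = T.e x * T.bar x * T.f a := by rw [← T.eq_e_mul_bar hx]
    _ = T.e x * a := by rw [h, mul_assoc, ← T.eq_bar_mul_f ha]
end
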